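/- arXiv:2209.02461 — 8 statements merged into one kernel-verified Lean document; each statement's English description precedes it below -/
import Mathlib

section
/- (Lemma 1, D-case.) Let n ≥ 2, let i be an index with i + 1 < n, let U be a random vector of n bits jointly distributed with side information Y, and define the transformed random vector V by V_i = U_i, V_{i+1} = U_i + U_{i+1}, and V_j = U_j for every j ∉ {i, i+1}. Then Γ_Y(V) = Γ_Y(U); i.e., applying the transform (U_i, U_{i+1}) ↦ (U_i, U_i + U_{i+1}) does not change the polarization functional Γ. -/
open MeasureTheory ProbabilityTheory

/-- Shannon entropy of a finitely-valued random variable. -/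
noncomputable def entropy {Ω S : Type*} [MeasurableSpace Ω] [Fintype S]
    (μ : Measure Ω) (X : Ω → S) : ℝ :=
  ∑ s : S, Real.negMulLog (μ (X ⁻¹' {s})).toReal

/-- Conditional Shannon entropy `H[X | Z]` of `X` given `Z`:
the average over the values `z` of `Z` of the entropy of `X` under the
conditional measure `μ[|Z ⁻¹' {z}]`. -/
noncomputable def condEntropy {Ω S T : Type*} [MeasurableSpace Ω] [Fintype S] [Fintype T]
    (μ : Measure Ω) (X : Ω → S) (Z : Ω → T) : ℝ :=
  ∑ z : T, (μ (Z ⁻¹' {z})).toReal * entropy (μ[|Z ⁻¹' {z}]) X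

/-- The `j`-th successive-cancellation entropy
`H_j(U) = H[U_j | ⟨(U_0, …, U_{j-1}), Y⟩]` of a random bit vector `U`
with side information `Y`. -/
noncomputable def scEntropy {Ω T : Type*} [MeasurableSpace Ω] [Fintype T] {n : ℕ}
    (μ : Measure Ω) (U : Ω → (Fin n → ZMod 2)) (Y : Ω → T) (j : Fin n) : ℝ :=
  condEntropy μ (fun ω => U ω j)
    (fun ω => ((fun k : Fin (j : ℕ) => U ω (Fin.castLE j.isLt.le k)), Y ω))

/-- The polarization functional
`Γ_Y(U) = (1/n) ∑_j H_j(U) (1 - H_j(U))`. -/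
noncomputable def Gamma {Ω T : Type*} [MeasurableSpace Ω] [Fintype T] {n : ℕ}
    (μ : Measure Ω) (U : Ω → (Fin n → ZMod 2)) (Y : Ω → T) : ℝ :=
  (1 / n) * ∑ j : Fin n, scEntropy μ U Y j * (1 - scEntropy μ U Y j)

theorem condEntropy_transport {Ω S T : Type*} [MeasurableSpace Ω] [Fintype S] [Fintype T]
    (μ : Measure Ω) (X X' : Ω → S) (Z Z' : Ω → T) (e : T ≃ T) (f : T → S ≃ S)
    (hZm : ∀ z, MeasurableSet (Z ⁻¹' {z}))
    (hZ : ∀ ω, Z' ω = e (Z ω)) (hX : ∀ ω, X' ω = f (Z ω) (X ω)) :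
    condEntropy μ X' Z' = condEntropy μ X Z := by
  unfold condEntropy
  rw [← Equiv.sum_comp e]
  refine Finset.sum_congr rfl fun z _ => ?_
  have h1 : Z' ⁻¹' {e z} = Z ⁻¹' {z} := by
    ext ω; simp [hZ]
  rw [h1]
  congr 1
  unfold entropy
  rw [← Equiv.sum_comp (f z)]
  refine Finset.sum_congr rfl fun s _ => ?_
  rw [ProbabilityTheory.cond_apply (hZm z), ProbabilityTheory.cond_apply (hZm z)]
  have h2 : Z ⁻¹' {z} ∩ X' ⁻¹' {f z s} = Z ⁻¹' {z} ∩ X ⁻¹' {s} := by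
    ext ω
    simp only [Set.mem_inter_iff, Set.mem_preimage, Set.mem_singleton_iff, hX]
    refine and_congr_right fun h => ?_
    rw [h]; simp
  rw [h2]

/-- The prefix transform. -/
def prefixD (i j : ℕ) (w : Fin j → ZMod 2) : Fin j → ZMod 2 := fun k =>
  if h : (k : ℕ) = i + 1 then w ⟨i, by omega⟩ + w k else w k

theorem prefixD_invol (i j : ℕ) : Function.Involutive (prefixD i j) := by
  intro w
  funext k
  unfold prefixD
  by_cases h : (k : ℕ) = i + 1
  · simp [h, ← add_assoc, CharTwo.add_self_eq_zero]
  · simp [h]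

/-- (Lemma 1, D-case.) Applying the transform
`(U_i, U_{i+1}) ↦ (U_i, U_i + U_{i+1})` to a pair of adjacent bits does not
change the polarization functional `Γ`. -/
theorem gamma_D_transform
    {Ω T : Type*} [MeasurableSpace Ω]
    [MeasurableSpace T] [Fintype T] [MeasurableSingletonClass T]
    (μ : Measure Ω) [IsProbabilityMeasure μ]
    {n : ℕ} (hn : 2 ≤ n) (i : ℕ) (hi : i + 1 < n)
    (U : Ω → (Fin n → ZMod 2)) (hU : Measurable U)
    (Y : Ω → T) (hY : Measurable Y)
    (V : Ω → (Fin n → ZMod 2))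
    (hVi : ∀ ω, V ω ⟨i, by omega⟩ = U ω ⟨i, by omega⟩)
    (hVi1 : ∀ ω, V ω ⟨i + 1, hi⟩ = U ω ⟨i, by omega⟩ + U ω ⟨i + 1, hi⟩)
    (hVj : ∀ ω, ∀ j : Fin n, (j : ℕ) ≠ i → (j : ℕ) ≠ i + 1 → V ω j = U ω j) :
    Gamma μ V Y = Gamma μ U Y := by
  unfold Gamma
  have key : ∀ j : Fin n, scEntropy μ V Y j = scEntropy μ U Y j := by
    intro j
    unfold scEntropy
    refine condEntropy_transport μ _ _ _ _
      (((prefixD_invol i j).toPerm).prodCongr (Equiv.refl T))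
      (fun z => Equiv.addLeft (if h : (j : ℕ) = i + 1 then z.1 ⟨i, by omega⟩ else 0))
      ?_ ?_ ?_
    · intro z
      have hm : Measurable (fun ω =>
          ((fun k : Fin (j : ℕ) => U ω (Fin.castLE j.isLt.le k)), Y ω)) := by
        refine Measurable.prodMk ?_ hY
        exact measurable_pi_lambda _ fun k => (measurable_pi_apply _).comp hU
      exact hm (measurableSet_singleton z)
    · intro ω
      refine Prod.ext ?_ rfl
      funext k
      change V ω (Fin.castLE j.isLt.le k) =
        prefixD i j (fun k : Fin (j : ℕ) => U ω (Fin.castLE j.isLt.le k)) k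
      unfold prefixD
      split_ifs with h
      · beta_reduce
        have e1 : Fin.castLE j.isLt.le k = ⟨i + 1, hi⟩ := Fin.ext h
        rw [e1, hVi1]
        rfl
      · by_cases h' : (k : ℕ) = i
        · beta_reduce
          have e1 : Fin.castLE j.isLt.le k = ⟨i, by omega⟩ := Fin.ext h'
          rw [e1, hVi]
        · exact hVj ω _ h' h
    · intro ω
      rw [Equiv.coe_addLeft]
      split_ifs with h
      · have e1 : j = ⟨i + 1, hi⟩ := Fin.ext h
        subst e1
        exact hVi1 ω
      · refine Eq.trans ?_ (zero_add _).symm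
        by_cases h' : (j : ℕ) = i
        · have e1 : j = ⟨i, by omega⟩ := Fin.ext h'
          rw [e1, hVi]
        · exact hVj ω _ h' h
  simp only [key]
end

section
/- (Lemma 1, E = S case.) Let n ≥ 2, let i be an index with i + 1 < n, and let U be a random vector of n bits jointly distributed with side information Y. Define the swapped vector S by S_i = U_{i+1}, S_{i+1} = U_i, S_j = U_j for j ∉ {i, i+1}, and the E-transformed vector E by E_i = U_{i+1}, E_{i+1} = U_i + U_{i+1}, E_j = U_j for j ∉ {i, i+1}. Then Γ_Y(E) = Γ_Y(S); i.e., the transform (U_i, U_{i+1}) ↦ (U_{i+1}, U_i + U_{i+1}) and the swapping transform (U_i, U_{i+1}) ↦ (U_{i+1}, U_i) yield the same value of the polarization functional Γ. -/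
open MeasureTheory ProbabilityTheory

theorem condEntropy_congr_equiv {Ω S T : Type*} [MeasurableSpace Ω] [Fintype S] [Fintype T]
    (μ : Measure Ω) (X X' : Ω → S) (Z Z' : Ω → T) (e : T ≃ T) (σ : T → S ≃ S)
    (hZ : ∀ z, MeasurableSet (Z ⁻¹' {z}))
    (he : ∀ ω, Z' ω = e (Z ω)) (hs : ∀ ω, X' ω = σ (Z ω) (X ω)) :
    condEntropy μ X' Z' = condEntropy μ X Z := by
  unfold condEntropy
  rw [← Equiv.sum_comp e]
  refine Finset.sum_congr rfl fun z _ => ?_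
  have h1 : Z' ⁻¹' {e z} = Z ⁻¹' {z} := by
    ext ω; simp [he]
  rw [h1]
  congr 1
  unfold entropy
  rw [← Equiv.sum_comp (σ z)]
  refine Finset.sum_congr rfl fun s _ => ?_
  rw [cond_apply (hZ z), cond_apply (hZ z)]
  congr 4
  ext ω
  simp only [Set.mem_inter_iff, Set.mem_preimage, Set.mem_singleton_iff]
  constructor
  · rintro ⟨rfl, h⟩
    exact ⟨rfl, by rw [hs] at h; exact (σ (Z ω)).injective h⟩
  · rintro ⟨rfl, rfl⟩
    exact ⟨rfl, hs ω⟩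

def shearFun (i m : ℕ) (v : Fin m → ZMod 2) : Fin m → ZMod 2 := fun k =>
  v k + if h : (k : ℕ) = i + 1 then v ⟨i, by have := k.isLt; omega⟩ else 0

theorem shearFun_invol (i m : ℕ) : Function.Involutive (shearFun i m) := by
  intro v
  funext k
  by_cases h : (k : ℕ) = i + 1
  · simp [shearFun, h, add_assoc, CharTwo.add_self_eq_zero]
  · simp [shearFun, h]

/-- (Lemma 1, E = S case.) The transform `(U_i, U_{i+1}) ↦ (U_{i+1}, U_i + U_{i+1})`
and the swapping transform `(U_i, U_{i+1}) ↦ (U_{i+1}, U_i)` yield the same value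
of the polarization functional `Γ`. -/
theorem gamma_E_eq_gamma_S
    {Ω T : Type*} [MeasurableSpace Ω]
    [MeasurableSpace T] [Fintype T] [MeasurableSingletonClass T]
    (μ : Measure Ω) [IsProbabilityMeasure μ]
    {n : ℕ} (hn : 2 ≤ n) (i : ℕ) (hi : i + 1 < n)
    (U : Ω → (Fin n → ZMod 2)) (hU : Measurable U)
    (Y : Ω → T) (hY : Measurable Y)
    (S E : Ω → (Fin n → ZMod 2))
    (hSi : ∀ ω, S ω ⟨i, by omega⟩ = U ω ⟨i + 1, hi⟩)
    (hSi1 : ∀ ω, S ω ⟨i + 1, hi⟩ = U ω ⟨i, by omega⟩)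
    (hSj : ∀ ω, ∀ j : Fin n, (j : ℕ) ≠ i → (j : ℕ) ≠ i + 1 → S ω j = U ω j)
    (hEi : ∀ ω, E ω ⟨i, by omega⟩ = U ω ⟨i + 1, hi⟩)
    (hEi1 : ∀ ω, E ω ⟨i + 1, hi⟩ = U ω ⟨i, by omega⟩ + U ω ⟨i + 1, hi⟩)
    (hEj : ∀ ω, ∀ j : Fin n, (j : ℕ) ≠ i → (j : ℕ) ≠ i + 1 → E ω j = U ω j) :
    Gamma μ E Y = Gamma μ S Y := by
  have hSm : Measurable S := by
    refine measurable_pi_iff.2 fun j => ?_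
    have hUj : ∀ k, Measurable fun ω => U ω k := fun k => measurable_pi_iff.1 hU k
    by_cases h1 : (j : ℕ) = i
    · obtain rfl : j = ⟨i, Nat.lt_of_succ_lt hi⟩ := Fin.ext h1
      simpa only [hSi] using hUj _
    · by_cases h2 : (j : ℕ) = i + 1
      · obtain rfl : j = ⟨i + 1, hi⟩ := Fin.ext h2
        simpa only [hSi1] using hUj _
      · simpa only [hSj _ j h1 h2] using hUj _
  have hES : ∀ ω (k : Fin n), E ω k = S ω k +
      if (k : ℕ) = i + 1 then S ω ⟨i, by omega⟩ else 0 := by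
    intro ω k
    by_cases h1 : (k : ℕ) = i
    · obtain rfl : k = ⟨i, Nat.lt_of_succ_lt hi⟩ := Fin.ext h1
      simp [hEi, hSi]
    · by_cases h2 : (k : ℕ) = i + 1
      · obtain rfl : k = ⟨i + 1, hi⟩ := Fin.ext h2
        simp [hEi1, hSi1, hSi]
      · simp [hEj ω k h1 h2, hSj ω k h1 h2, h2]
  have key : ∀ j, scEntropy μ E Y j = scEntropy μ S Y j := by
    intro j
    unfold scEntropy
    refine condEntropy_congr_equiv μ _ _ _ _
      (Equiv.prodCongr (shearFun_invol i j).toPerm (Equiv.refl T))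
      (fun z => Equiv.addRight
        (if h : (j : ℕ) = i + 1 then z.1 ⟨i, by omega⟩ else 0)) ?_ ?_ ?_
    · intro z
      have hm : Measurable (fun ω =>
          ((fun k : Fin (j : ℕ) => S ω (Fin.castLE j.isLt.le k)), Y ω)) := by
        refine Measurable.prodMk (measurable_pi_iff.2 fun k => ?_) hY
        exact measurable_pi_iff.1 hSm _
      exact hm (measurableSet_singleton z)
    · intro ω
      refine Prod.ext ?_ rfl
      funext k
      by_cases h : (k : ℕ) = i + 1 <;> simp [hES, shearFun, h]
    · intro ω
      by_cases h : (j : ℕ) = i + 1 <;> simp [hES, h]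
  unfold Gamma
  simp only [key]
end

section
/- (Lemma 1, K = A case.) Let n ≥ 2, let i be an index with i + 1 < n, and let U be a random vector of n bits jointly distributed with side information Y. Define the Arıkan-transformed vector A by A_i = U_i + U_{i+1}, A_{i+1} = U_{i+1}, A_j = U_j for j ∉ {i, i+1}, and the K-transformed vector K by K_i = U_i + U_{i+1}, K_{i+1} = U_i, K_j = U_j for j ∉ {i, i+1}. Then Γ_Y(K) = Γ_Y(A); i.e., the transform (U_i, U_{i+1}) ↦ (U_i + U_{i+1}, U_i) and the Arıkan transform (U_i, U_{i+1}) ↦ (U_i + U_{i+1}, U_{i+1}) yield the same value of the polarization functional Γ. -/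
open MeasureTheory ProbabilityTheory

theorem condEntropy_relabel_side {Ω S T : Type*} [MeasurableSpace Ω] [Fintype S] [Fintype T]
    (μ : Measure Ω) (X : Ω → S) (Z Z' : Ω → T) (e : T ≃ T) (h : ∀ ω, Z' ω = e (Z ω)) :
    condEntropy μ X Z' = condEntropy μ X Z := by
  unfold condEntropy
  rw [← Equiv.sum_comp e]
  refine Finset.sum_congr rfl fun z _ => ?_
  have : Z' ⁻¹' {e z} = Z ⁻¹' {z} := by
    ext ω; simp [h]
  rw [this]

theorem condEntropy_relabel_main {Ω S T : Type*} [MeasurableSpace Ω] [Fintype S] [Fintype T]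
    (μ : Measure Ω) (X X' : Ω → S) (Z : Ω → T) (hZ : ∀ z, MeasurableSet (Z ⁻¹' {z}))
    (f : T → S ≃ S) (h : ∀ ω, X' ω = f (Z ω) (X ω)) :
    condEntropy μ X' Z = condEntropy μ X Z := by
  unfold condEntropy entropy
  refine Finset.sum_congr rfl fun z _ => ?_
  congr 1
  rw [← Equiv.sum_comp (f z)]
  refine Finset.sum_congr rfl fun s _ => ?_
  rw [cond_apply (hZ z), cond_apply (hZ z)]
  have : Z ⁻¹' {z} ∩ X' ⁻¹' {f z s} = Z ⁻¹' {z} ∩ X ⁻¹' {s} := by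
    ext ω
    simp only [Set.mem_inter_iff, Set.mem_preimage, Set.mem_singleton_iff, h]
    constructor
    · rintro ⟨rfl, h2⟩; exact ⟨rfl, (f _).injective h2⟩
    · rintro ⟨rfl, rfl⟩; exact ⟨rfl, rfl⟩
  rw [this]

/-- Involution adding coordinate `a` to coordinate `b`. -/
def flipEquiv {j : ℕ} (a b : Fin j) (hab : a ≠ b) : (Fin j → ZMod 2) ≃ (Fin j → ZMod 2) where
  toFun v := Function.update v b (v a + v b)
  invFun v := Function.update v b (v a + v b)
  left_inv v := by
    ext k
    by_cases hk : k = b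
    · subst hk; simp [hab, ← add_assoc, CharTwo.add_self_eq_zero]
    · simp [hk]
  right_inv v := by
    ext k
    by_cases hk : k = b
    · subst hk; simp [hab, ← add_assoc, CharTwo.add_self_eq_zero]
    · simp [hk]

/-- (Lemma 1, K = A case.) The transform `(U_i, U_{i+1}) ↦ (U_i + U_{i+1}, U_i)`
and the Arıkan transform `(U_i, U_{i+1}) ↦ (U_i + U_{i+1}, U_{i+1})` yield the
same value of the polarization functional `Γ`. -/
theorem gamma_K_eq_gamma_A
    {Ω T : Type*} [MeasurableSpace Ω]
    [MeasurableSpace T] [Fintype T] [MeasurableSingletonClass T]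
    (μ : Measure Ω) [IsProbabilityMeasure μ]
    {n : ℕ} (hn : 2 ≤ n) (i : ℕ) (hi : i + 1 < n)
    (U : Ω → (Fin n → ZMod 2)) (hU : Measurable U)
    (Y : Ω → T) (hY : Measurable Y)
    (A K : Ω → (Fin n → ZMod 2))
    (hAi : ∀ ω, A ω ⟨i, by omega⟩ = U ω ⟨i, by omega⟩ + U ω ⟨i + 1, hi⟩)
    (hAi1 : ∀ ω, A ω ⟨i + 1, hi⟩ = U ω ⟨i + 1, hi⟩)
    (hAj : ∀ ω, ∀ j : Fin n, (j : ℕ) ≠ i → (j : ℕ) ≠ i + 1 → A ω j = U ω j)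
    (hKi : ∀ ω, K ω ⟨i, by omega⟩ = U ω ⟨i, by omega⟩ + U ω ⟨i + 1, hi⟩)
    (hKi1 : ∀ ω, K ω ⟨i + 1, hi⟩ = U ω ⟨i, by omega⟩)
    (hKj : ∀ ω, ∀ j : Fin n, (j : ℕ) ≠ i → (j : ℕ) ≠ i + 1 → K ω j = U ω j) :
    Gamma μ K Y = Gamma μ A Y := by
  have hKA : ∀ ω, ∀ j : Fin n, (j : ℕ) ≠ i + 1 → K ω j = A ω j := by
    intro ω j hj
    by_cases h : (j : ℕ) = i
    · obtain rfl : j = ⟨i, Nat.lt_of_succ_lt hi⟩ := Fin.ext h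
      rw [hKi, hAi]
    · rw [hKj ω j h hj, hAj ω j h hj]
  have hK1 : ∀ ω, K ω ⟨i + 1, hi⟩ = A ω ⟨i, by omega⟩ + A ω ⟨i + 1, hi⟩ := by
    intro ω
    rw [hKi1, hAi, hAi1, add_assoc, CharTwo.add_self_eq_zero, add_zero]
  have hAm : ∀ k : Fin n, Measurable fun ω => A ω k := by
    intro k
    have hc : ∀ k, Measurable fun ω => U ω k := fun k => (measurable_pi_apply k).comp hU
    by_cases h : (k : ℕ) = i
    · obtain rfl : k = ⟨i, Nat.lt_of_succ_lt hi⟩ := Fin.ext h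
      simp only [hAi]
      exact (hc _).add (hc _)
    by_cases h' : (k : ℕ) = i + 1
    · obtain rfl : k = ⟨i + 1, hi⟩ := Fin.ext h'
      simp only [hAi1]
      exact hc _
    · simp only [fun ω => hAj ω k h h']
      exact hc _
  have key : ∀ j, scEntropy μ K Y j = scEntropy μ A Y j := by
    intro j
    unfold scEntropy
    rcases lt_trichotomy (j : ℕ) (i + 1) with h | h | h
    · congr 1
      · funext ω; exact hKA ω j (by omega)
      · funext ω
        congr 1
        funext k
        exact hKA ω _ (by simp only [Fin.val_castLE]; omega)
    · obtain rfl : j = ⟨i + 1, hi⟩ := Fin.ext h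
      have e1 : (fun ω => ((fun k : Fin (i + 1) => K ω (Fin.castLE hi.le k)), Y ω))
          = (fun ω => ((fun k : Fin (i + 1) => A ω (Fin.castLE hi.le k)), Y ω)) := by
        funext ω
        congr 1
        funext k
        exact hKA ω _ (by simp only [Fin.val_castLE]; omega)
      change condEntropy μ _ (fun ω => ((fun k : Fin (i + 1) => K ω (Fin.castLE hi.le k)), Y ω))
        = condEntropy μ _ (fun ω => ((fun k : Fin (i + 1) => A ω (Fin.castLE hi.le k)), Y ω))
      rw [e1]
      refine condEntropy_relabel_main μ _ _ _ ?_
        (fun z => Equiv.addLeft (z.1 (Fin.last i))) ?_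
      · intro z
        exact ((measurable_pi_lambda _ fun k => hAm _).prodMk hY) (measurableSet_singleton z)
      · intro ω
        exact hK1 ω
    · have e1 : (fun ω => K ω j) = fun ω => A ω j := by
        funext ω; exact hKA ω j (by omega)
      rw [e1]
      refine condEntropy_relabel_side μ _ _ _
        ((flipEquiv (⟨i, by omega⟩ : Fin j) ⟨i + 1, h⟩ (by simp)).prodCongr (Equiv.refl T)) ?_
      intro ω
      refine Prod.ext ?_ rfl
      funext k
      by_cases hk : k = ⟨i + 1, h⟩
      · subst hk
        simp [flipEquiv]
        exact hK1 ω
      · simp [flipEquiv, hk]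
        exact hKA ω _ (fun h' => hk (Fin.ext h'))
  unfold Gamma
  simp only [key]
end

section
/- (Entropy conservation of the Arıkan transform.) If the pairs ⟨X₁, Y₁⟩ and ⟨X₂, Y₂⟩ are independent, where X₁, X₂ are random bits and Y₁, Y₂ are side information, then H[(fun ω => X₁ ω + X₂ ω) | ⟨Y₁, Y₂⟩] + H[X₂ | ⟨(fun ω => X₁ ω + X₂ ω), ⟨Y₁, Y₂⟩⟩] = H[X₁ | Y₁] + H[X₂ | Y₂]. -/
open MeasureTheory ProbabilityTheory

theorem chain_aux {Ω S T : Type*} [MeasurableSpace Ω] [Fintype S] [Fintype T]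
    (μ : Measure Ω) [IsProbabilityMeasure μ] (X : Ω → S) (Z : Ω → T)
    (hX : ∀ s, MeasurableSet (X ⁻¹' {s})) (hZ : ∀ z, MeasurableSet (Z ⁻¹' {z})) :
    condEntropy μ X Z = entropy μ (fun ω => (X ω, Z ω)) - entropy μ Z := by
  have hsum : ∀ z, ∑ s, (μ (Z ⁻¹' {z} ∩ X ⁻¹' {s})).toReal = (μ (Z ⁻¹' {z})).toReal := by
    intro z
    have h1 : Z ⁻¹' {z} = ⋃ s ∈ (Finset.univ : Finset S), (Z ⁻¹' {z} ∩ X ⁻¹' {s}) := by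
      ext ω; simp
    conv_rhs => rw [h1]
    rw [measure_biUnion_finset]
    · rw [ENNReal.toReal_sum]
      intro s _; exact measure_ne_top _ _
    · intro a _ b _ hab
      refine Set.disjoint_left.mpr ?_
      rintro ω ⟨_, h⟩ ⟨_, h'⟩
      simp at h h'
      exact hab (h.symm.trans h')
    · intro s _; exact (hZ z).inter (hX s)
  unfold condEntropy entropy
  rw [Fintype.sum_prod_type, Finset.sum_comm, ← Finset.sum_sub_distrib]
  refine Finset.sum_congr rfl fun z _ => ?_
  have hpre : ∀ s, (fun ω => (X ω, Z ω)) ⁻¹' {(s, z)} = Z ⁻¹' {z} ∩ X ⁻¹' {s} := by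
    intro s; ext ω; simp [and_comm]
  simp only [hpre, cond_apply (hZ z), ENNReal.toReal_mul, ENNReal.toReal_inv]
  rw [Finset.mul_sum]
  have key : ∀ s, (μ (Z ⁻¹' {z})).toReal * Real.negMulLog ((μ (Z ⁻¹' {z})).toReal⁻¹ *
      (μ (Z ⁻¹' {z} ∩ X ⁻¹' {s})).toReal) = Real.negMulLog (μ (Z ⁻¹' {z} ∩ X ⁻¹' {s})).toReal
      + (μ (Z ⁻¹' {z} ∩ X ⁻¹' {s})).toReal * Real.log (μ (Z ⁻¹' {z})).toReal := by
    intro s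
    have hle : (μ (Z ⁻¹' {z} ∩ X ⁻¹' {s})).toReal ≤ (μ (Z ⁻¹' {z})).toReal :=
      ENNReal.toReal_mono (measure_ne_top _ _) (measure_mono Set.inter_subset_left)
    have h0 : 0 ≤ (μ (Z ⁻¹' {z} ∩ X ⁻¹' {s})).toReal := ENNReal.toReal_nonneg
    generalize (μ (Z ⁻¹' {z} ∩ X ⁻¹' {s})).toReal = p at *
    generalize (μ (Z ⁻¹' {z})).toReal = q at *
    by_cases hp : p = 0
    · simp [hp]
    have hq : q ≠ 0 := by
      rintro rfl; exact hp (le_antisymm hle h0)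
    unfold Real.negMulLog
    rw [Real.log_mul (inv_ne_zero hq) hp, Real.log_inv]
    field_simp
    ring
  rw [Finset.sum_congr rfl fun s _ => key s, Finset.sum_add_distrib, ← Finset.sum_mul, hsum]
  unfold Real.negMulLog
  ring

theorem entropy_equiv_aux {Ω S T : Type*} [MeasurableSpace Ω] [Fintype S] [Fintype T]
    (μ : Measure Ω) (X : Ω → S) (e : S ≃ T) :
    entropy μ (fun ω => e (X ω)) = entropy μ X := by
  unfold entropy
  rw [← e.sum_comp]
  refine Finset.sum_congr rfl fun s _ => ?_
  congr 3
  ext ω; simp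

theorem entropy_indep_aux {Ω S T : Type*} [MeasurableSpace Ω] [Fintype S] [Fintype T]
    [MeasurableSpace S] [MeasurableSpace T]
    [MeasurableSingletonClass S] [MeasurableSingletonClass T]
    (μ : Measure Ω) [IsProbabilityMeasure μ] (X : Ω → S) (Z : Ω → T)
    (hX : Measurable X) (hZ : Measurable Z) (h : IndepFun X Z μ) :
    entropy μ (fun ω => (X ω, Z ω)) = entropy μ X + entropy μ Z := by
  have one : ∀ {R : Type _} [Fintype R] [MeasurableSpace R] [MeasurableSingletonClass R]
      (W : Ω → R), Measurable W → ∑ r, (μ (W ⁻¹' {r})).toReal = 1 := by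
    intro R _ _ _ W hW
    rw [← ENNReal.toReal_sum (fun _ _ => measure_ne_top _ _),
      sum_measure_preimage_singleton _ (fun y _ => hW (measurableSet_singleton y))]
    simp
  have one' : ∀ {R : Type _} [Fintype R] [MeasurableSpace R] [MeasurableSingletonClass R]
      (W : Ω → R), Measurable W → ∑ r, (μ (W ⁻¹' {r})).toReal = 1 := by
    intro R _ _ _ W hW
    rw [← ENNReal.toReal_sum (fun _ _ => measure_ne_top _ _),
      sum_measure_preimage_singleton _ (fun y _ => hW (measurableSet_singleton y))]
    simp
  have hm : ∀ s z, (μ ((fun ω => (X ω, Z ω)) ⁻¹' {(s, z)})).toReal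
      = (μ (X ⁻¹' {s})).toReal * (μ (Z ⁻¹' {z})).toReal := by
    intro s z
    have hpre : (fun ω => (X ω, Z ω)) ⁻¹' {(s, z)} = X ⁻¹' {s} ∩ Z ⁻¹' {z} := by
      ext ω; simp
    rw [hpre, h.measure_inter_preimage_eq_mul _ _ (measurableSet_singleton s)
      (measurableSet_singleton z), ENNReal.toReal_mul]
  unfold entropy
  rw [Fintype.sum_prod_type]
  simp only [hm, Real.negMulLog_mul, Finset.sum_add_distrib, ← Finset.mul_sum, ← Finset.sum_mul]
  rw [one X hX, one' Z hZ]
  simp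

/-- (Entropy conservation of the Arıkan transform.) If the pairs `⟨X₁, Y₁⟩` and
`⟨X₂, Y₂⟩` are independent, then
`H[X₁ + X₂ | ⟨Y₁, Y₂⟩] + H[X₂ | ⟨X₁ + X₂, ⟨Y₁, Y₂⟩⟩] = H[X₁ | Y₁] + H[X₂ | Y₂]`. -/
theorem arikan_entropy_conservation
    {Ω T₁ T₂ : Type*} [MeasurableSpace Ω]
    [MeasurableSpace T₁] [Fintype T₁] [MeasurableSingletonClass T₁]
    [MeasurableSpace T₂] [Fintype T₂] [MeasurableSingletonClass T₂]
    (μ : Measure Ω) [IsProbabilityMeasure μ]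
    (X₁ X₂ : Ω → ZMod 2) (hX₁ : Measurable X₁) (hX₂ : Measurable X₂)
    (Y₁ : Ω → T₁) (hY₁ : Measurable Y₁) (Y₂ : Ω → T₂) (hY₂ : Measurable Y₂)
    (hindep : IndepFun (fun ω => (X₁ ω, Y₁ ω)) (fun ω => (X₂ ω, Y₂ ω)) μ) :
    condEntropy μ (fun ω => X₁ ω + X₂ ω) (fun ω => (Y₁ ω, Y₂ ω)) +
      condEntropy μ X₂ (fun ω => (X₁ ω + X₂ ω, (Y₁ ω, Y₂ ω))) =
      condEntropy μ X₁ Y₁ + condEntropy μ X₂ Y₂ := by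
  have hS : Measurable (fun ω => X₁ ω + X₂ ω) :=
    (measurable_of_countable (fun p : ZMod 2 × ZMod 2 => p.1 + p.2)).comp (hX₁.prodMk hX₂)
  have hYY : ∀ r, MeasurableSet ((fun ω => (Y₁ ω, Y₂ ω)) ⁻¹' {r}) :=
    fun r => (hY₁.prodMk hY₂) (measurableSet_singleton r)
  have hSYY : ∀ r, MeasurableSet ((fun ω => (X₁ ω + X₂ ω, (Y₁ ω, Y₂ ω))) ⁻¹' {r}) :=
    fun r => (hS.prodMk (hY₁.prodMk hY₂)) (measurableSet_singleton r)
  have hYi : IndepFun Y₁ Y₂ μ := hindep.comp measurable_snd measurable_snd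
  let e : ((ZMod 2 × T₁) × (ZMod 2 × T₂)) ≃ (ZMod 2 × (ZMod 2 × (T₁ × T₂))) :=
    { toFun := fun p => (p.2.1, (p.1.1 + p.2.1, (p.1.2, p.2.2)))
      invFun := fun q => ((q.2.1 - q.1, q.2.2.1), (q.1, q.2.2.2))
      left_inv := by rintro ⟨⟨a, b⟩, ⟨c, d⟩⟩; simp
      right_inv := by rintro ⟨a, b, c, d⟩; simp }
  have h1 := entropy_equiv_aux μ (fun ω => ((X₁ ω, Y₁ ω), (X₂ ω, Y₂ ω))) e
  have h2 := entropy_indep_aux μ _ _ (hX₁.prodMk hY₁) (hX₂.prodMk hY₂) hindep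
  have h3 := entropy_indep_aux μ _ _ hY₁ hY₂ hYi
  rw [chain_aux μ _ _ (fun r => hS (measurableSet_singleton r)) hYY,
    chain_aux μ _ _ (fun r => hX₂ (measurableSet_singleton r)) hSYY,
    chain_aux μ _ _ (fun r => hX₁ (measurableSet_singleton r))
      (fun r => hY₁ (measurableSet_singleton r)),
    chain_aux μ _ _ (fun r => hX₂ (measurableSet_singleton r))
      (fun r => hY₂ (measurableSet_singleton r))]
  simp only [e, Equiv.coe_fn_mk] at h1
  linarith
end

section
/- (Minus-transform increases entropy.) If the pairs ⟨X₁, Y₁⟩ and ⟨X₂, Y₂⟩ are independent, where X₁, X₂ are random bits and Y₁, Y₂ are side information, then H[(fun ω => X₁ ω + X₂ ω) | ⟨Y₁, Y₂⟩] ≥ H[X₁ | Y₁]. -/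
open MeasureTheory ProbabilityTheory

lemma conv_entropy_ge (p q : ZMod 2 → ℝ) (hp : ∀ a, 0 ≤ p a) (hq : ∀ a, 0 ≤ q a)
    (hq1 : ∑ a, q a = 1) :
    ∑ s, Real.negMulLog (p s) ≤ ∑ s, Real.negMulLog (∑ a, q a * p (s - a)) := by
  have h : ∀ s, ∑ a, q a * Real.negMulLog (p (s - a)) ≤
      Real.negMulLog (∑ a, q a * p (s - a)) := by
    intro s
    have := Real.concaveOn_negMulLog.le_map_sum (t := Finset.univ) (w := q)
      (p := fun a => p (s - a)) (fun i _ => hq i) hq1 (fun i _ => hp _)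
    simpa [smul_eq_mul] using this
  refine le_trans (le_of_eq ?_) (Finset.sum_le_sum fun s _ => h s)
  rw [Finset.sum_comm]
  have h2 : ∀ a, ∑ s, q a * Real.negMulLog (p (s - a)) = q a * ∑ s, Real.negMulLog (p s) := by
    intro a
    rw [← Finset.mul_sum]
    congr 1
    exact (Equiv.subRight a).sum_comp (fun s => Real.negMulLog (p s))
  simp_rw [h2]
  rw [← Finset.sum_mul, hq1, one_mul]

lemma cond_toReal {Ω : Type*} [MeasurableSpace Ω] (μ : Measure Ω) (A B : Set Ω)
    (hA : MeasurableSet A) :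
    ((μ[|A]) B).toReal = (μ A).toReal⁻¹ * (μ (A ∩ B)).toReal := by
  rw [cond_apply hA, ENNReal.toReal_mul, ENNReal.toReal_inv]

lemma sum_fiber {Ω : Type*} [MeasurableSpace Ω] (μ : Measure Ω) [IsFiniteMeasure μ]
    {T : Type*} [Fintype T] [MeasurableSpace T] [MeasurableSingletonClass T]
    (X : Ω → T) (hX : Measurable X) (A : Set Ω) (hA : MeasurableSet A) :
    (μ A).toReal = ∑ a, (μ (A ∩ X ⁻¹' {a})).toReal := by
  rw [← ENNReal.toReal_sum (fun _ _ => measure_ne_top _ _), ← tsum_fintype (L := .unconditional _),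
    ← measure_iUnion]
  · congr 2
    ext ω; simp
  · intro a b hab
    refine Set.disjoint_left.2 ?_
    rintro ω ⟨_, h1⟩ ⟨_, h2⟩
    exact hab (h1.symm.trans h2)
  · exact fun a => hA.inter (hX (measurableSet_singleton a))

/-- (Minus-transform increases entropy.) If the pairs `⟨X₁, Y₁⟩` and `⟨X₂, Y₂⟩`
are independent, then `H[X₁ + X₂ | ⟨Y₁, Y₂⟩] ≥ H[X₁ | Y₁]`. -/
theorem minus_transform_increases_entropy
    {Ω T₁ T₂ : Type*} [MeasurableSpace Ω]
    [MeasurableSpace T₁] [Fintype T₁] [MeasurableSingletonClass T₁]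
    [MeasurableSpace T₂] [Fintype T₂] [MeasurableSingletonClass T₂]
    (μ : Measure Ω) [IsProbabilityMeasure μ]
    (X₁ X₂ : Ω → ZMod 2) (hX₁ : Measurable X₁) (hX₂ : Measurable X₂)
    (Y₁ : Ω → T₁) (hY₁ : Measurable Y₁) (Y₂ : Ω → T₂) (hY₂ : Measurable Y₂)
    (hindep : IndepFun (fun ω => (X₁ ω, Y₁ ω)) (fun ω => (X₂ ω, Y₂ ω)) μ) :
    condEntropy μ (fun ω => X₁ ω + X₂ ω) (fun ω => (Y₁ ω, Y₂ ω)) ≥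
      condEntropy μ X₁ Y₁ := by
  have mX : ∀ a : ZMod 2, MeasurableSet ({a} : Set (ZMod 2)) := fun a => measurableSet_singleton a
  have mY₁ : ∀ y, MeasurableSet (Y₁ ⁻¹' {y}) := fun y => hY₁ (measurableSet_singleton y)
  have mY₂ : ∀ y, MeasurableSet (Y₂ ⁻¹' {y}) := fun y => hY₂ (measurableSet_singleton y)
  have hsum : Measurable (fun ω => X₁ ω + X₂ ω) := hX₁.add hX₂
  have hZ : ∀ y₁ y₂, (fun ω => (Y₁ ω, Y₂ ω)) ⁻¹' {(y₁, y₂)} = Y₁ ⁻¹' {y₁} ∩ Y₂ ⁻¹' {y₂} := by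
    intro y₁ y₂; ext ω; simp
  have hPQ : ∀ y₁ y₂, (μ (Y₁ ⁻¹' {y₁} ∩ Y₂ ⁻¹' {y₂})).toReal =
      (μ (Y₁ ⁻¹' {y₁})).toReal * (μ (Y₂ ⁻¹' {y₂})).toReal := by
    intro y₁ y₂
    have := (hindep.comp measurable_snd measurable_snd).measure_inter_preimage_eq_mul
      {y₁} {y₂} (measurableSet_singleton _) (measurableSet_singleton _)
    rw [← ENNReal.toReal_mul]
    exact congrArg ENNReal.toReal this
  have hJ : ∀ y₁ y₂ a b, (μ ((Y₁ ⁻¹' {y₁} ∩ X₁ ⁻¹' {a}) ∩ (Y₂ ⁻¹' {y₂} ∩ X₂ ⁻¹' {b}))).toReal =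
      (μ (Y₁ ⁻¹' {y₁} ∩ X₁ ⁻¹' {a})).toReal * (μ (Y₂ ⁻¹' {y₂} ∩ X₂ ⁻¹' {b})).toReal := by
    intro y₁ y₂ a b
    have := hindep.measure_inter_preimage_eq_mul
      {(a, y₁)} {(b, y₂)} (measurableSet_singleton _) (measurableSet_singleton _)
    have e1 : (fun ω => (X₁ ω, Y₁ ω)) ⁻¹' {(a, y₁)} = Y₁ ⁻¹' {y₁} ∩ X₁ ⁻¹' {a} := by
      ext ω; simp [and_comm]
    have e2 : (fun ω => (X₂ ω, Y₂ ω)) ⁻¹' {(b, y₂)} = Y₂ ⁻¹' {y₂} ∩ X₂ ⁻¹' {b} := by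
      ext ω; simp [and_comm]
    rw [e1, e2] at this
    rw [← ENNReal.toReal_mul, this]
  have key : ∀ y₁ y₂, (μ (Y₁ ⁻¹' {y₁})).toReal * (μ (Y₂ ⁻¹' {y₂})).toReal *
        entropy (μ[|Y₁ ⁻¹' {y₁}]) X₁ ≤
      (μ (Y₁ ⁻¹' {y₁})).toReal * (μ (Y₂ ⁻¹' {y₂})).toReal *
        entropy (μ[|Y₁ ⁻¹' {y₁} ∩ Y₂ ⁻¹' {y₂}]) (fun ω => X₁ ω + X₂ ω) := by
    intro y₁ y₂
    by_cases hQ : (μ (Y₂ ⁻¹' {y₂})).toReal = 0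
    · simp [hQ]
    refine mul_le_mul_of_nonneg_left ?_ (by positivity)
    have hc := conv_entropy_ge (fun a => ((μ[|Y₁ ⁻¹' {y₁}]) (X₁ ⁻¹' {a})).toReal)
      (fun a => ((μ[|Y₂ ⁻¹' {y₂}]) (X₂ ⁻¹' {a})).toReal) (fun _ => ENNReal.toReal_nonneg)
      (fun _ => ENNReal.toReal_nonneg) (by
        simp_rw [cond_toReal μ _ _ (mY₂ y₂)]
        rw [← Finset.mul_sum, ← sum_fiber μ X₂ hX₂ _ (mY₂ y₂), inv_mul_cancel₀ hQ])
    unfold entropy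
    refine hc.trans (le_of_eq ?_)
    refine Finset.sum_congr rfl fun s _ => ?_
    congr 1
    rw [cond_toReal μ _ _ ((mY₁ y₁).inter (mY₂ y₂)), hPQ,
      sum_fiber μ X₂ hX₂ _ (((mY₁ y₁).inter (mY₂ y₂)).inter
        (hsum (mX s))), Finset.mul_sum]
    refine Finset.sum_congr rfl fun a _ => ?_
    have e : Y₁ ⁻¹' {y₁} ∩ Y₂ ⁻¹' {y₂} ∩ (fun ω => X₁ ω + X₂ ω) ⁻¹' {s} ∩ X₂ ⁻¹' {a} =
        (Y₁ ⁻¹' {y₁} ∩ X₁ ⁻¹' {s - a}) ∩ (Y₂ ⁻¹' {y₂} ∩ X₂ ⁻¹' {a}) := by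
      ext ω
      simp only [Set.mem_inter_iff, Set.mem_preimage, Set.mem_singleton_iff, eq_sub_iff_add_eq]
      constructor
      · rintro ⟨⟨⟨h1, h2⟩, h3⟩, h4⟩
        exact ⟨⟨h1, h4 ▸ h3⟩, h2, h4⟩
      · rintro ⟨⟨h1, h3⟩, h2, h4⟩
        exact ⟨⟨⟨h1, h2⟩, h4 ▸ h3⟩, h4⟩
    have e' := hJ y₁ y₂ (s - a) a
    rw [← e] at e'
    simp only [cond_toReal μ _ _ (mY₁ y₁), cond_toReal μ _ _ (mY₂ y₂)]
    refine Eq.trans ?_ (congrArg (_ * ·) e'.symm)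
    rw [mul_inv]
    ring
  have hQ1 : ∑ y₂, (μ (Y₂ ⁻¹' {y₂})).toReal = 1 := by
    have := sum_fiber μ Y₂ hY₂ Set.univ MeasurableSet.univ
    simpa using this.symm
  show condEntropy μ X₁ Y₁ ≤ _
  unfold condEntropy
  rw [Fintype.sum_prod_type]
  refine Finset.sum_le_sum fun y₁ _ => ?_
  calc _ = ∑ y₂, (μ (Y₁ ⁻¹' {y₁})).toReal * (μ (Y₂ ⁻¹' {y₂})).toReal *
        entropy (μ[|Y₁ ⁻¹' {y₁}]) X₁ := by
        rw [← Finset.sum_mul, ← Finset.mul_sum, hQ1, mul_one]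
    _ ≤ _ := by
      refine Finset.sum_le_sum fun y₂ _ => ?_
      rw [hZ, hPQ]
      exact key y₁ y₂
end

section
/- (Polarization ordering, equation (4) of Lemma 2.) If the pairs ⟨X₁, Y₁⟩ and ⟨X₂, Y₂⟩ are independent and identically distributed, where X₁, X₂ are random bits and Y₁, Y₂ are side information, then H[(fun ω => X₁ ω + X₂ ω) | ⟨Y₁, Y₂⟩] ≥ H[X₁ | Y₁] ≥ H[X₂ | ⟨(fun ω => X₁ ω + X₂ ω), ⟨Y₁, Y₂⟩⟩]. -/
open MeasureTheory ProbabilityTheory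

lemma condEntropy_formula {Ω S T : Type*} [MeasurableSpace Ω] [Fintype S] [Fintype T]
    (μ : Measure Ω) [IsProbabilityMeasure μ] (X : Ω → S) (Z : Ω → T)
    (p : S → T → ℝ)
    (hX : ∀ s, MeasurableSet (X ⁻¹' {s})) (hZ : ∀ z, MeasurableSet (Z ⁻¹' {z}))
    (hp : ∀ s z, (μ (Z ⁻¹' {z} ∩ X ⁻¹' {s})).toReal = p s z) :
    condEntropy μ X Z
      = ∑ z, ((∑ s, Real.negMulLog (p s z)) - Real.negMulLog (∑ s, p s z)) := by
  classical
  unfold condEntropy entropy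
  refine Finset.sum_congr rfl fun z _ => ?_
  have hsum : ∑ s, p s z = (μ (Z ⁻¹' {z})).toReal := by
    have h1 : μ (Z ⁻¹' {z}) = ∑ s, μ (Z ⁻¹' {z} ∩ X ⁻¹' {s}) := by
      rw [← measure_biUnion_finset]
      · congr 1; ext ω; simp
      · intro a _ b _ hab
        rw [Function.onFun, Set.disjoint_left]
        rintro ω ⟨_, h1⟩ ⟨_, h2⟩
        simp only [Set.mem_preimage, Set.mem_singleton_iff] at h1 h2
        exact hab (h1.symm.trans h2)
      · intro s _; exact (hZ z).inter (hX s)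
    rw [h1, ENNReal.toReal_sum (fun s _ => measure_ne_top _ _)]
    exact Finset.sum_congr rfl fun s _ => (hp s z).symm
  rw [hsum]
  set P := (μ (Z ⁻¹' {z})).toReal with hP
  have hc : ∀ s, ((μ[|Z ⁻¹' {z}]) (X ⁻¹' {s})).toReal = P⁻¹ * p s z := by
    intro s
    rw [cond_apply (hZ z), ENNReal.toReal_mul, ENNReal.toReal_inv, hp]
  simp_rw [hc]
  by_cases h0 : P = 0
  · have : ∀ s, p s z = 0 := by
      intro s
      have h2 : p s z ≤ P := by
        rw [← hp]
        exact ENNReal.toReal_mono (measure_ne_top _ _) (measure_mono Set.inter_subset_left)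
      have h3 : 0 ≤ p s z := by rw [← hp]; exact ENNReal.toReal_nonneg
      linarith
    simp [this, h0]
  · have h4 : ∀ s, Real.negMulLog (p s z)
        = P⁻¹ * p s z * Real.negMulLog P + P * Real.negMulLog (P⁻¹ * p s z) := by
      intro s
      rw [← Real.negMulLog_mul, ← mul_assoc, mul_inv_cancel₀ h0, one_mul]
    simp_rw [h4]
    rw [Finset.sum_add_distrib, ← Finset.sum_mul, ← Finset.mul_sum, ← Finset.mul_sum, hsum,
      inv_mul_cancel₀ h0]
    ring

lemma mix_ineq (a b c d : ℝ) (ha : 0 ≤ a) (hb : 0 ≤ b) (hc : 0 ≤ c) (hd : 0 ≤ d) :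
    (c + d) * (Real.negMulLog a + Real.negMulLog b - Real.negMulLog (a + b)) ≤
      Real.negMulLog (a * c + b * d) + Real.negMulLog (a * d + b * c)
        - Real.negMulLog ((a + b) * (c + d)) := by
  rcases eq_or_lt_of_le (add_nonneg hc hd) with h | h
  · have hc0 : c = 0 := by linarith
    have hd0 : d = 0 := by linarith
    simp [hc0, hd0]
  · set r := c + d with hr
    have hq : c / r + d / r = 1 := by rw [← add_div, ← hr, div_self h.ne']
    have hq' : d / r + c / r = 1 := by rw [add_comm, hq]
    have e1 := Real.concaveOn_negMulLog.2 (Set.mem_Ici.2 ha) (Set.mem_Ici.2 hb)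
      (div_nonneg hc h.le) (div_nonneg hd h.le) hq
    have e2 := Real.concaveOn_negMulLog.2 (Set.mem_Ici.2 ha) (Set.mem_Ici.2 hb)
      (div_nonneg hd h.le) (div_nonneg hc h.le) hq'
    simp only [smul_eq_mul] at e1 e2
    have f1 : a * c + b * d = (c / r * a + d / r * b) * r := by field_simp
    have f2 : a * d + b * c = (d / r * a + c / r * b) * r := by field_simp
    rw [f1, f2, Real.negMulLog_mul, Real.negMulLog_mul, Real.negMulLog_mul]
    have e3 := mul_le_mul_of_nonneg_left (add_le_add e1 e2) h.le
    have g1 : d / r = 1 - c / r := by linarith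
    rw [g1] at e3 ⊢
    nlinarith [e3]

/-- (Polarization ordering, equation (4) of Lemma 2.) If the pairs `⟨X₁, Y₁⟩` and
`⟨X₂, Y₂⟩` are independent and identically distributed, then
`H[X₁ + X₂ | ⟨Y₁, Y₂⟩] ≥ H[X₁ | Y₁] ≥ H[X₂ | ⟨X₁ + X₂, ⟨Y₁, Y₂⟩⟩]`. -/
theorem polarization_ordering
    {Ω T : Type*} [MeasurableSpace Ω]
    [MeasurableSpace T] [Fintype T] [MeasurableSingletonClass T]
    (μ : Measure Ω) [IsProbabilityMeasure μ]
    (X₁ X₂ : Ω → ZMod 2) (hX₁ : Measurable X₁) (hX₂ : Measurable X₂)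
    (Y₁ Y₂ : Ω → T) (hY₁ : Measurable Y₁) (hY₂ : Measurable Y₂)
    (hindep : IndepFun (fun ω => (X₁ ω, Y₁ ω)) (fun ω => (X₂ ω, Y₂ ω)) μ)
    (hid : IdentDistrib (fun ω => (X₁ ω, Y₁ ω)) (fun ω => (X₂ ω, Y₂ ω)) μ μ) :
    condEntropy μ (fun ω => X₁ ω + X₂ ω) (fun ω => (Y₁ ω, Y₂ ω)) ≥
        condEntropy μ X₁ Y₁ ∧
      condEntropy μ X₁ Y₁ ≥
        condEntropy μ X₂ (fun ω => (X₁ ω + X₂ ω, (Y₁ ω, Y₂ ω))) := by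
  classical
  set g : ZMod 2 → T → ℝ := fun x y => (μ (Y₁ ⁻¹' {y} ∩ X₁ ⁻¹' {x})).toReal with hg
  have g0 : ∀ x y, 0 ≤ g x y := fun x y => ENNReal.toReal_nonneg
  have mX₁ : ∀ s, MeasurableSet (X₁ ⁻¹' {s}) := fun s => hX₁ (measurableSet_singleton s)
  have mX₂ : ∀ s, MeasurableSet (X₂ ⁻¹' {s}) := fun s => hX₂ (measurableSet_singleton s)
  have mY₁ : ∀ s, MeasurableSet (Y₁ ⁻¹' {s}) := fun s => hY₁ (measurableSet_singleton s)
  have mY₂ : ∀ s, MeasurableSet (Y₂ ⁻¹' {s}) := fun s => hY₂ (measurableSet_singleton s)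
  have pre1 : ∀ x y, (fun ω => (X₁ ω, Y₁ ω)) ⁻¹' {(x, y)} = Y₁ ⁻¹' {y} ∩ X₁ ⁻¹' {x} := by
    intro x y; ext ω; simp [and_comm]
  have g2 : ∀ x y, μ ((fun ω => (X₂ ω, Y₂ ω)) ⁻¹' {(x, y)}) = μ (Y₁ ⁻¹' {y} ∩ X₁ ⁻¹' {x}) := by
    intro x y
    rw [← pre1]
    exact (hid.measure_mem_eq (measurableSet_singleton (x, y))).symm
  have joint : ∀ x y x' y', (μ ((fun ω => (X₁ ω, Y₁ ω)) ⁻¹' {(x, y)} ∩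
      (fun ω => (X₂ ω, Y₂ ω)) ⁻¹' {(x', y')})).toReal = g x y * g x' y' := by
    intro x y x' y'
    rw [hindep.measure_inter_preimage_eq_mul _ _ (measurableSet_singleton _)
      (measurableSet_singleton _), g2, pre1, ENNReal.toReal_mul]
  have mP : ∀ x y, MeasurableSet ((fun ω => (X₁ ω, Y₁ ω)) ⁻¹' {(x, y)}) := by
    intro x y; rw [pre1]; exact (mY₁ y).inter (mX₁ x)
  have mP2 : ∀ x y, MeasurableSet ((fun ω => (X₂ ω, Y₂ ω)) ⁻¹' {(x, y)}) := by
    intro x y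
    exact (hX₂.prodMk hY₂) (measurableSet_singleton _)
  have mS : ∀ s, MeasurableSet ((fun ω => X₁ ω + X₂ ω) ⁻¹' {s}) := fun s =>
    (hX₁.add hX₂) (measurableSet_singleton s)
  have mYY : ∀ z, MeasurableSet ((fun ω => (Y₁ ω, Y₂ ω)) ⁻¹' {z}) := fun z =>
    (hY₁.prodMk hY₂) (measurableSet_singleton z)
  have mSYY : ∀ z, MeasurableSet ((fun ω => (X₁ ω + X₂ ω, (Y₁ ω, Y₂ ω))) ⁻¹' {z}) := fun z =>
    ((hX₁.add hX₂).prodMk (hY₁.prodMk hY₂)) (measurableSet_singleton z)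
  have hC' : ∀ (x : ZMod 2) (z : ZMod 2 × T × T),
      (μ ((fun ω => (X₁ ω + X₂ ω, (Y₁ ω, Y₂ ω))) ⁻¹' {z} ∩ X₂ ⁻¹' {x})).toReal
        = g (z.1 - x) z.2.1 * g x z.2.2 := by
    rintro x ⟨u, y, y'⟩
    rw [← joint]
    congr 2
    ext ω
    simp only [Set.mem_inter_iff, Set.mem_preimage, Set.mem_singleton_iff, Prod.mk.injEq]
    constructor
    · rintro ⟨⟨h1, h2, h3⟩, h4⟩
      exact ⟨⟨by rw [← h1, ← h4]; ring, h2⟩, h4, h3⟩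
    · rintro ⟨⟨h1, h2⟩, h4, h3⟩
      exact ⟨⟨by rw [h1, h4]; ring, h2, h3⟩, h4⟩
  have hA' : ∀ (u : ZMod 2) (z : T × T),
      (μ ((fun ω => (Y₁ ω, Y₂ ω)) ⁻¹' {z} ∩ (fun ω => X₁ ω + X₂ ω) ⁻¹' {u})).toReal
        = ∑ x, g (u - x) z.1 * g x z.2 := by
    intro u z
    simp_rw [← hC' _ (u, z)]
    rw [← ENNReal.toReal_sum (fun s _ => measure_ne_top _ _), ← measure_biUnion_finset]
    · congr 2; ext ω; simp [and_comm]
    · intro a _ b _ hab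
      rw [Function.onFun, Set.disjoint_left]
      rintro ω ⟨_, h1⟩ ⟨_, h2⟩
      simp only [Set.mem_preimage, Set.mem_singleton_iff] at h1 h2
      exact hab (h1.symm.trans h2)
    · intro s _; exact (mSYY _).inter (mX₂ s)
  have sum2 : ∀ f : ZMod 2 → ℝ, ∑ x, f x = f 0 + f 1 := fun f => Fin.sum_univ_two f
  have htot : ∑ y, (g 0 y + g 1 y) = 1 := by
    have h0 : ∀ y, g 0 y + g 1 y = ∑ x, g x y := fun y => (sum2 (fun x => g x y)).symm
    simp_rw [h0]
    rw [Finset.sum_comm, ← Fintype.sum_prod_type']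
    have h1 : ∀ z : ZMod 2 × T, g z.1 z.2
        = (μ ((fun ω => (X₁ ω, Y₁ ω)) ⁻¹' {z})).toReal := by
      rintro ⟨x, y⟩; rw [pre1]
    simp_rw [h1]
    rw [← ENNReal.toReal_sum (fun s _ => measure_ne_top _ _), ← measure_biUnion_finset]
    · have : (⋃ b ∈ (Finset.univ : Finset (ZMod 2 × T)), (fun ω => (X₁ ω, Y₁ ω)) ⁻¹' {b})
          = Set.univ := by ext ω; simp
      rw [this]; simp
    · intro a _ b _ hab
      rw [Function.onFun, Set.disjoint_left]
      intro ω h1 h2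
      exact hab (h1.symm.trans h2)
    · rintro ⟨x, y⟩ _; exact mP x y
  have s1 : (0 : ZMod 2) - 1 = 1 := by decide
  have A := condEntropy_formula μ _ _ _ mS mYY hA'
  have B := condEntropy_formula μ _ _ g mX₁ mY₁ (fun x y => rfl)
  have C := condEntropy_formula μ _ _ _ mX₂ mSYY hC'
  simp only [Fintype.sum_prod_type, sum2, s1, sub_zero, sub_self] at A B C
  rw [A, B, C]
  set h : T → ℝ := fun y => Real.negMulLog (g 0 y) + Real.negMulLog (g 1 y)
    - Real.negMulLog (g 0 y + g 1 y) with hh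
  have hB1 : ∑ y, ∑ y', (g 0 y' + g 1 y') * h y = ∑ y, h y := by
    simp_rw [← Finset.sum_mul, htot, one_mul]
  have hB2 : ∑ y, ∑ y', (g 0 y + g 1 y) * h y' = ∑ y, h y := by
    rw [Finset.sum_comm]; exact hB1
  have key : ∑ y, h y ≤ ∑ y, ∑ y', (Real.negMulLog (g 0 y * g 0 y' + g 1 y * g 1 y')
      + Real.negMulLog (g 1 y * g 0 y' + g 0 y * g 1 y')
      - Real.negMulLog (g 0 y * g 0 y' + g 1 y * g 1 y' + (g 1 y * g 0 y' + g 0 y * g 1 y'))) := by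
    rw [← hB1]
    refine Finset.sum_le_sum fun y _ => Finset.sum_le_sum fun y' _ => ?_
    have := mix_ineq (g 0 y) (g 1 y) (g 0 y') (g 1 y') (g0 _ _) (g0 _ _) (g0 _ _) (g0 _ _)
    have f1 : g 0 y * g 0 y' + g 1 y * g 1 y' + (g 1 y * g 0 y' + g 0 y * g 1 y')
      = (g 0 y + g 1 y) * (g 0 y' + g 1 y') := by ring
    rw [f1, add_comm (g 1 y * g 0 y')]
    exact this
  refine ⟨key, ?_⟩
  have e : ∑ y, h y + ∑ y, h y = ∑ y, ∑ y', ((g 0 y' + g 1 y') * h y + (g 0 y + g 1 y) * h y') := by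
    simp_rw [Finset.sum_add_distrib]; rw [hB1, hB2]
  suffices hs : ∑ y, h y + ∑ y, h y = (∑ y, ∑ y', (Real.negMulLog (g 0 y * g 0 y' + g 1 y * g 1 y')
      + Real.negMulLog (g 1 y * g 0 y' + g 0 y * g 1 y')
      - Real.negMulLog (g 0 y * g 0 y' + g 1 y * g 1 y' + (g 1 y * g 0 y' + g 0 y * g 1 y'))))
      + ((∑ y, ∑ y', (Real.negMulLog (g 0 y * g 0 y') + Real.negMulLog (g 1 y * g 1 y')
        - Real.negMulLog (g 0 y * g 0 y' + g 1 y * g 1 y')))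
      + ∑ y, ∑ y', (Real.negMulLog (g 1 y * g 0 y') + Real.negMulLog (g 0 y * g 1 y')
        - Real.negMulLog (g 1 y * g 0 y' + g 0 y * g 1 y'))) by
    linarith
  rw [e]
  simp_rw [← Finset.sum_add_distrib]
  refine Finset.sum_congr rfl fun y _ => Finset.sum_congr rfl fun y' _ => ?_
  have f : g 0 y * g 0 y' + g 1 y * g 1 y' + (g 1 y * g 0 y' + g 0 y * g 1 y')
      = (g 0 y + g 1 y) * (g 0 y' + g 1 y') := by ring
  rw [f]
  simp only [Real.negMulLog_mul, hh]
  ring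
end

section
/- (Lemma 2, local form.) Let Û₁, Û₂ be random bits and Ỹ₁, Ỹ₂ side information such that, setting X̃₁ = Û₁ + Û₂ and X̃₂ = Û₂, the pairs ⟨X̃₁, Ỹ₁⟩ and ⟨X̃₂, Ỹ₂⟩ are independent and identically distributed. Define the successive-cancellation entropy pairs for the identity, swapping, and Arıkan transforms of (Û₁, Û₂): h₁ = H[Û₁ | ⟨Ỹ₁, Ỹ₂⟩], h₂ = H[Û₂ | ⟨Û₁, ⟨Ỹ₁, Ỹ₂⟩⟩]; s₁ = H[Û₂ | ⟨Ỹ₁, Ỹ₂⟩], s₂ = H[Û₁ | ⟨Û₂, ⟨Ỹ₁, Ỹ₂⟩⟩]; a₁ = H[(fun ω => Û₁ ω + Û₂ ω) | ⟨Ỹ₁, Ỹ₂⟩], a₂ = H[Û₂ | ⟨(fun ω => Û₁ ω + Û₂ ω), ⟨Ỹ₁, Ỹ₂⟩⟩]. Then s₁ = s₂ = a₁ = a₂ = H[X̃₁ | Ỹ₁], and s₁·(1−s₁) + s₂·(1−s₂) = a₁·(1−a₁) + a₂·(1−a₂) ≥ h₁·(1−h₁) + h₂·(1−h₂). (Thus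 applying the swapping or the Arıkan transform to such a pair of adjacent bits does not decrease the polarization functional Γ, and the two transforms give the same value.) -/
open MeasureTheory ProbabilityTheory

lemma entropy_comp_equiv' {Ω S S' : Type*} [MeasurableSpace Ω] [Fintype S] [Fintype S']
    (μ : Measure Ω) (X : Ω → S) (Y : Ω → S') (e : S ≃ S') (h : ∀ ω, Y ω = e (X ω)) :
    entropy μ Y = entropy μ X := by
  unfold entropy
  refine (Fintype.sum_equiv e _ _ fun s => ?_).symm
  congr 3
  ext ω
  simp [h]

lemma sum_joint {Ω S T : Type*} [MeasurableSpace Ω] [Fintype S] [MeasurableSpace S]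
    [MeasurableSingletonClass S]
    (μ : Measure Ω) [IsProbabilityMeasure μ] (X : Ω → S) (hX : Measurable X) (A : Set Ω)
    (hA : MeasurableSet A) :
    ∑ s, (μ (A ∩ X ⁻¹' {s})).toReal = (μ A).toReal := by
  rw [← ENNReal.toReal_sum (fun _ _ => measure_ne_top _ _)]
  congr 1
  rw [← measure_biUnion_finset]
  · congr 1
    ext ω
    simp
  · intro i _ j _ hij
    refine Set.disjoint_left.2 fun ω h1 h2 => hij ?_
    simp at h1 h2
    rw [← h1.2, ← h2.2]
  · intro i _
    exact hA.inter (hX (measurableSet_singleton i))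

lemma condEntropy_chain {Ω S T : Type*} [MeasurableSpace Ω] [Fintype S] [Fintype T]
    [MeasurableSpace S] [MeasurableSingletonClass S]
    [MeasurableSpace T] [MeasurableSingletonClass T]
    (μ : Measure Ω) [IsProbabilityMeasure μ] (X : Ω → S) (Z : Ω → T)
    (hX : Measurable X) (hZ : Measurable Z) :
    condEntropy μ X Z = entropy μ (fun ω => (Z ω, X ω)) - entropy μ Z := by
  unfold condEntropy entropy
  rw [Fintype.sum_prod_type, ← Finset.sum_sub_distrib]
  refine Finset.sum_congr rfl fun z _ => ?_
  have hz : MeasurableSet (Z ⁻¹' {z}) := hZ (measurableSet_singleton z)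
  have hpre : ∀ s, (fun ω => (Z ω, X ω)) ⁻¹' {(z, s)} = Z ⁻¹' {z} ∩ X ⁻¹' {s} := by
    intro s; ext ω; simp
  simp only [hpre]
  have hsum := sum_joint (T := T) μ X hX _ hz
  by_cases h0 : (μ (Z ⁻¹' {z})).toReal = 0
  · have h0' : μ (Z ⁻¹' {z}) = 0 := by
      simpa [ENNReal.toReal_eq_zero_iff] using h0
    have : ∀ s, μ (Z ⁻¹' {z} ∩ X ⁻¹' {s}) = 0 :=
      fun s => measure_mono_null Set.inter_subset_left h0'
    simp [this, h0']
  · have hc : ∀ s, (μ[|Z ⁻¹' {z}] (X ⁻¹' {s})).toReal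
        = (μ (Z ⁻¹' {z} ∩ X ⁻¹' {s})).toReal / (μ (Z ⁻¹' {z})).toReal := by
      intro s
      rw [cond_apply hz, ENNReal.toReal_mul, ENNReal.toReal_inv]
      ring
    simp only [hc]
    generalize (μ (Z ⁻¹' {z})).toReal = p at *
    generalize hq : (fun s => (μ (Z ⁻¹' {z} ∩ X ⁻¹' {s})).toReal) = q at *
    have hq' : ∀ s, (μ (Z ⁻¹' {z} ∩ X ⁻¹' {s})).toReal = q s := fun s => by rw [← hq]
    simp only [hq'] at hsum ⊢
    have : ∀ s, p * Real.negMulLog (q s / p) = Real.negMulLog (q s) + q s * Real.log p := by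
      intro s
      unfold Real.negMulLog
      by_cases hs : q s = 0
      · simp [hs]
      · rw [Real.log_div hs h0]
        field_simp
        ring
    rw [Finset.mul_sum, Finset.sum_congr rfl (fun s _ => this s), Finset.sum_add_distrib,
      ← Finset.sum_mul, hsum]
    unfold Real.negMulLog
    ring

lemma entropy_indep {Ω S T : Type*} [MeasurableSpace Ω] [Fintype S] [Fintype T]
    [MeasurableSpace S] [MeasurableSingletonClass S]
    [MeasurableSpace T] [MeasurableSingletonClass T]
    (μ : Measure Ω) [IsProbabilityMeasure μ] (X : Ω → S) (Z : Ω → T)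
    (hX : Measurable X) (hZ : Measurable Z) (h : IndepFun X Z μ) :
    entropy μ (fun ω => (X ω, Z ω)) = entropy μ X + entropy μ Z := by
  unfold entropy
  rw [Fintype.sum_prod_type]
  have hpre : ∀ s t, (μ ((fun ω => (X ω, Z ω)) ⁻¹' {(s, t)})).toReal
      = (μ (X ⁻¹' {s})).toReal * (μ (Z ⁻¹' {t})).toReal := by
    intro s t
    rw [← ENNReal.toReal_mul, ← h.measure_inter_preimage_eq_mul _ _ (measurableSet_singleton s)
      (measurableSet_singleton t)]
    congr 2
    ext ω; simp
  have h1 : ∑ s, (μ (X ⁻¹' {s})).toReal = 1 := by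
    simpa using sum_joint (T := T) μ X hX _ MeasurableSet.univ
  have h2 : ∑ s, (μ (Z ⁻¹' {s})).toReal = 1 := by
    simpa using sum_joint (T := T) μ Z hZ _ MeasurableSet.univ
  simp only [hpre, Real.negMulLog_mul, Finset.sum_add_distrib, ← Finset.sum_mul, ← Finset.mul_sum,
    h1, h2, one_mul]

lemma entropy_ident {Ω S : Type*} [MeasurableSpace Ω] [Fintype S]
    [MeasurableSpace S] [MeasurableSingletonClass S]
    (μ : Measure Ω) (X Y : Ω → S) (h : IdentDistrib X Y μ μ) :
    entropy μ X = entropy μ Y := by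
  unfold entropy
  refine Finset.sum_congr rfl fun s _ => ?_
  rw [h.measure_mem_eq (measurableSet_singleton s)]

/-- (Lemma 2, local form.) Let `Û₁, Û₂` be random bits and `Ỹ₁, Ỹ₂` side
information such that, setting `X̃₁ = Û₁ + Û₂` and `X̃₂ = Û₂`, the pairs
`⟨X̃₁, Ỹ₁⟩` and `⟨X̃₂, Ỹ₂⟩` are independent and identically distributed. Then the
successive-cancellation entropy pairs of the swapping and Arıkan transforms of
`(Û₁, Û₂)` all equal `H[X̃₁ | Ỹ₁]`, and the corresponding values of the
polarization summand dominate that of the identity transform. -/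
theorem lemma2_local_form
    {Ω T : Type*} [MeasurableSpace Ω]
    [MeasurableSpace T] [Fintype T] [MeasurableSingletonClass T]
    (μ : Measure Ω) [IsProbabilityMeasure μ]
    (U₁ U₂ : Ω → ZMod 2) (hU₁ : Measurable U₁) (hU₂ : Measurable U₂)
    (Y₁ Y₂ : Ω → T) (hY₁ : Measurable Y₁) (hY₂ : Measurable Y₂)
    (hindep : IndepFun (fun ω => (U₁ ω + U₂ ω, Y₁ ω)) (fun ω => (U₂ ω, Y₂ ω)) μ)
    (hid : IdentDistrib (fun ω => (U₁ ω + U₂ ω, Y₁ ω)) (fun ω => (U₂ ω, Y₂ ω)) μ μ)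
    (h₁ h₂ s₁ s₂ a₁ a₂ : ℝ)
    (hh₁ : h₁ = condEntropy μ U₁ (fun ω => (Y₁ ω, Y₂ ω)))
    (hh₂ : h₂ = condEntropy μ U₂ (fun ω => (U₁ ω, (Y₁ ω, Y₂ ω))))
    (hs₁ : s₁ = condEntropy μ U₂ (fun ω => (Y₁ ω, Y₂ ω)))
    (hs₂ : s₂ = condEntropy μ U₁ (fun ω => (U₂ ω, (Y₁ ω, Y₂ ω))))
    (ha₁ : a₁ = condEntropy μ (fun ω => U₁ ω + U₂ ω) (fun ω => (Y₁ ω, Y₂ ω)))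
    (ha₂ : a₂ = condEntropy μ U₂ (fun ω => (U₁ ω + U₂ ω, (Y₁ ω, Y₂ ω)))) :
    (s₁ = condEntropy μ (fun ω => U₁ ω + U₂ ω) Y₁ ∧
     s₂ = condEntropy μ (fun ω => U₁ ω + U₂ ω) Y₁ ∧
     a₁ = condEntropy μ (fun ω => U₁ ω + U₂ ω) Y₁ ∧
     a₂ = condEntropy μ (fun ω => U₁ ω + U₂ ω) Y₁) ∧
    s₁ * (1 - s₁) + s₂ * (1 - s₂) = a₁ * (1 - a₁) + a₂ * (1 - a₂) ∧
    a₁ * (1 - a₁) + a₂ * (1 - a₂) ≥ h₁ * (1 - h₁) + h₂ * (1 - h₂) := by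
  have : MeasurableSingletonClass (ZMod 2) := inferInstance
  have hX : Measurable (fun ω => U₁ ω + U₂ ω) := hU₁.add hU₂
  have iYY : IndepFun Y₁ Y₂ μ := hindep.comp measurable_snd measurable_snd
  have iYP : IndepFun Y₁ (fun ω => (U₂ ω, Y₂ ω)) μ := hindep.comp measurable_snd measurable_id
  have iPY : IndepFun (fun ω => (U₁ ω + U₂ ω, Y₁ ω)) Y₂ μ :=
    hindep.comp measurable_id measurable_snd
  have dY : IdentDistrib Y₁ Y₂ μ μ := hid.comp measurable_snd
  have eP := entropy_ident μ _ _ hid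
  have eY := entropy_ident μ _ _ dY
  have eYY := entropy_indep μ _ _ hY₁ hY₂ iYY
  have eYP := entropy_indep μ _ _ hY₁ (hU₂.prodMk hY₂) iYP
  have ePY := entropy_indep μ _ _ (hX.prodMk hY₁) hY₂ iPY
  have ePP := entropy_indep μ _ _ (hX.prodMk hY₁) (hU₂.prodMk hY₂) hindep
  have hYY := hY₁.prodMk hY₂
  rw [condEntropy_chain μ _ _ hU₁ hYY] at hh₁
  rw [condEntropy_chain μ _ _ hU₂ (hU₁.prodMk hYY)] at hh₂
  rw [condEntropy_chain μ _ _ hU₂ hYY] at hs₁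
  rw [condEntropy_chain μ _ _ hU₁ (hU₂.prodMk hYY)] at hs₂
  rw [condEntropy_chain μ _ _ hX hYY] at ha₁
  rw [condEntropy_chain μ _ _ hU₂ (hX.prodMk hYY)] at ha₂
  rw [condEntropy_chain μ _ _ hX hY₁]
  have b0 : entropy μ (fun ω => (Y₁ ω, U₁ ω + U₂ ω)) = entropy μ (fun ω => (U₁ ω + U₂ ω, Y₁ ω)) :=
    entropy_comp_equiv' μ _ _ (Equiv.prodComm _ _) (fun _ => rfl)
  have b1 : entropy μ (fun ω => (U₁ ω, (Y₁ ω, Y₂ ω)))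
      = entropy μ (fun ω => ((Y₁ ω, Y₂ ω), U₁ ω)) :=
    entropy_comp_equiv' μ _ _ (Equiv.prodComm _ _) (fun _ => rfl)
  have b2 : entropy μ (fun ω => ((Y₁ ω, Y₂ ω), U₂ ω))
      = entropy μ (fun ω => (Y₁ ω, (U₂ ω, Y₂ ω))) :=
    entropy_comp_equiv' μ _ _ ⟨fun p => ((p.1, p.2.2), p.2.1), fun p => (p.1.1, (p.2, p.1.2)),
      fun _ => rfl, fun _ => rfl⟩ (fun _ => rfl)
  have b3 : entropy μ (fun ω => (U₂ ω, (Y₁ ω, Y₂ ω)))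
      = entropy μ (fun ω => (Y₁ ω, (U₂ ω, Y₂ ω))) :=
    entropy_comp_equiv' μ _ _ ⟨fun p => (p.2.1, (p.1, p.2.2)), fun p => (p.2.1, (p.1, p.2.2)),
      fun _ => rfl, fun _ => rfl⟩ (fun _ => rfl)
  have b4 : entropy μ (fun ω => ((Y₁ ω, Y₂ ω), U₁ ω + U₂ ω))
      = entropy μ (fun ω => ((U₁ ω + U₂ ω, Y₁ ω), Y₂ ω)) :=
    entropy_comp_equiv' μ _ _ ⟨fun p => ((p.1.2, p.2), p.1.1), fun p => ((p.2, p.1.1), p.1.2),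
      fun _ => rfl, fun _ => rfl⟩ (fun _ => rfl)
  have b5 : entropy μ (fun ω => (U₁ ω + U₂ ω, (Y₁ ω, Y₂ ω)))
      = entropy μ (fun ω => ((U₁ ω + U₂ ω, Y₁ ω), Y₂ ω)) :=
    entropy_comp_equiv' μ _ _ (Equiv.prodAssoc _ _ _) (fun _ => rfl)
  have b6 : entropy μ (fun ω => ((U₁ ω + U₂ ω, (Y₁ ω, Y₂ ω)), U₂ ω))
      = entropy μ (fun ω => ((U₁ ω + U₂ ω, Y₁ ω), (U₂ ω, Y₂ ω))) :=
    entropy_comp_equiv' μ _ _ ⟨fun p => ((p.1.1, (p.1.2, p.2.2)), p.2.1),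
      fun p => ((p.1.1, p.1.2.1), (p.2, p.1.2.2)), fun _ => rfl, fun _ => rfl⟩ (fun _ => rfl)
  have b7 : entropy μ (fun ω => ((U₁ ω, (Y₁ ω, Y₂ ω)), U₂ ω))
      = entropy μ (fun ω => ((U₁ ω + U₂ ω, Y₁ ω), (U₂ ω, Y₂ ω))) :=
    entropy_comp_equiv' μ _ _ ⟨fun p => ((p.1.1 - p.2.1, (p.1.2, p.2.2)), p.2.1),
      fun p => ((p.1.1 + p.2, p.1.2.1), (p.2, p.1.2.2)), fun _ => by simp, fun _ => by simp⟩
      (fun _ => by simp)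
  have b8 : entropy μ (fun ω => ((U₂ ω, (Y₁ ω, Y₂ ω)), U₁ ω))
      = entropy μ (fun ω => ((U₁ ω + U₂ ω, Y₁ ω), (U₂ ω, Y₂ ω))) :=
    entropy_comp_equiv' μ _ _ ⟨fun p => ((p.2.1, (p.1.2, p.2.2)), p.1.1 - p.2.1),
      fun p => ((p.2 + p.1.1, p.1.2.1), (p.1.1, p.1.2.2)), fun _ => by simp, fun _ => by simp⟩
      (fun _ => by simp)
  have c1 : s₁ = entropy μ (fun ω => (Y₁ ω, U₁ ω + U₂ ω)) - entropy μ Y₁ := by linarith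
  have c2 : s₂ = entropy μ (fun ω => (Y₁ ω, U₁ ω + U₂ ω)) - entropy μ Y₁ := by linarith
  have c3 : a₁ = entropy μ (fun ω => (Y₁ ω, U₁ ω + U₂ ω)) - entropy μ Y₁ := by linarith
  have c4 : a₂ = entropy μ (fun ω => (Y₁ ω, U₁ ω + U₂ ω)) - entropy μ Y₁ := by linarith
  have c5 : h₁ + h₂ = a₁ + a₂ := by linarith
  refine ⟨⟨c1, c2, c3, c4⟩, by rw [c1, c2, c3, c4], ?_⟩
  have e2 : a₂ = a₁ := c4.trans c3.symm
  rw [e2] at c5 ⊢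
  have e3 : h₂ = a₁ + a₁ - h₁ := by linarith
  rw [e3]
  nlinarith [sq_nonneg (h₁ - a₁)]
end

section
/- (Conservation of total conditional entropy under invertible encoding, equation (2).) Let n ≥ 1, let U : Ω → (Fin n → ZMod 2) be a measurable random vector of bits, let G be an invertible n×n matrix over ZMod 2, and set X ω = Matrix.vecMul (U ω) G. Let Y : Ω → (Fin n → 𝒴) be side information with each Y_i taking values in a finite measurable space, and suppose the n pairs ⟨X_i, Y_i⟩ (i = 0,…,n−1) are mutually independent and identically distributed. Then the successive-cancellation entropies of U satisfy ∑_{j=0}^{n−1} H[(fun ω => U ω j) | ⟨(fun ω => fun k : Fin j => U ω (Fin.castLE (by omega) k)), Y⟩] = n · H[(fun ω => X ω 0) | (fun ω => Y ω 0)]. -/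
open MeasureTheory ProbabilityTheory

section Helpers

lemma sc_chain {Ω S T : Type*} [MeasurableSpace Ω] [Fintype S] [Fintype T]
    (μ : Measure Ω) [IsProbabilityMeasure μ] (X : Ω → S) (Z : Ω → T)
    (hX : ∀ s, MeasurableSet (X ⁻¹' {s})) (hZ : ∀ s, MeasurableSet (Z ⁻¹' {s})) :
    condEntropy μ X Z = entropy μ (fun ω => (X ω, Z ω)) - entropy μ Z := by
  unfold condEntropy entropy
  rw [Fintype.sum_prod_type_right, ← Finset.sum_sub_distrib]
  refine Finset.sum_congr rfl fun z _ => ?_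
  have hpre : ∀ s, (fun ω => (X ω, Z ω)) ⁻¹' {(s, z)} = Z ⁻¹' {z} ∩ X ⁻¹' {s} := by
    intro s; ext ω; simp [and_comm]
  simp only [hpre]
  have hsum : ∑ s, (μ (Z ⁻¹' {z} ∩ X ⁻¹' {s})).toReal = (μ (Z ⁻¹' {z})).toReal := by
    have h := sum_measureReal_preimage_singleton (μ := μ.restrict (Z ⁻¹' {z})) Finset.univ
      (f := X) (fun y _ => hX y)
    simp only [Finset.coe_univ, Set.preimage_univ, measureReal_def, Measure.restrict_apply (hX _),
      Measure.restrict_apply_univ] at h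
    rw [← h]
    simp only [Set.inter_comm]
  simp only [cond_apply (hZ z), ENNReal.toReal_mul, ENNReal.toReal_inv]
  set p := (μ (Z ⁻¹' {z})).toReal with hp
  generalize hq : (fun s => (μ (Z ⁻¹' {z} ∩ X ⁻¹' {s})).toReal) = q at *
  have hq' : ∀ s, (μ (Z ⁻¹' {z} ∩ X ⁻¹' {s})).toReal = q s := fun s => congrFun hq s
  have hq0 : ∀ s, 0 ≤ q s := fun s => by rw [← hq']; exact ENNReal.toReal_nonneg
  simp only [hq'] at hsum ⊢
  by_cases h0 : p = 0
  · rw [h0] at hsum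
    have := (Finset.sum_eq_zero_iff_of_nonneg (fun s _ => hq0 s)).1 hsum
    simp [h0, fun s => this s (Finset.mem_univ s)]
  · have : ∀ s, Real.negMulLog (q s) =
        p⁻¹ * q s * Real.negMulLog p + p * Real.negMulLog (p⁻¹ * q s) := by
      intro s
      rw [← Real.negMulLog_mul, mul_inv_cancel_left₀ h0]
    rw [Finset.sum_congr rfl (fun s _ => this s), Finset.sum_add_distrib, ← Finset.sum_mul,
      ← Finset.mul_sum, ← Finset.mul_sum, hsum, inv_mul_cancel₀ h0]
    ring

lemma sc_inj {Ω S T : Type*} [MeasurableSpace Ω] [Fintype S] [Fintype T]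
    (μ : Measure Ω) (A : Ω → S) (e : S → T) (he : Function.Injective e) :
    entropy μ (fun ω => e (A ω)) = entropy μ A := by
  classical
  unfold entropy
  symm
  apply Finset.sum_of_injOn e he.injOn (by simp)
  · intro t _ ht
    have : (fun ω => e (A ω)) ⁻¹' {t} = ∅ := by
      ext ω
      simp only [Set.mem_preimage, Set.mem_singleton_iff, Set.mem_empty_iff_false, iff_false]
      rintro rfl
      exact ht ⟨A ω, by simp, rfl⟩
    simp [this]
  · intro s _
    have : (fun ω => e (A ω)) ⁻¹' {e s} = A ⁻¹' {s} := by
      ext ω; simp [he.eq_iff]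
    rw [this]

lemma sc_negMulLog_prod {ι : Type*} [DecidableEq ι] (t : Finset ι) (p : ι → ℝ) :
    Real.negMulLog (∏ i ∈ t, p i) =
      ∑ i ∈ t, ∏ j ∈ t, if j = i then Real.negMulLog (p j) else p j := by
  induction t using Finset.induction_on with
  | empty => simp
  | insert a t ha ih =>
    rw [Finset.prod_insert ha, Real.negMulLog_mul, ih, Finset.sum_insert ha,
      Finset.prod_insert ha, Finset.mul_sum]
    congr 1
    · rw [if_pos rfl, mul_comm]
      congr 1
      refine Finset.prod_congr rfl fun j hj => ?_
      rw [if_neg (by rintro rfl; exact ha hj)]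
    · refine Finset.sum_congr rfl fun i hi => ?_
      rw [Finset.prod_insert ha, if_neg (by rintro rfl; exact ha hi)]

lemma sc_indep {Ω S : Type*} [MeasurableSpace Ω] [Fintype S] [MeasurableSpace S]
    [MeasurableSingletonClass S] {n : ℕ}
    (μ : Measure Ω) [IsProbabilityMeasure μ] (W : Fin n → Ω → S)
    (hW : ∀ i, Measurable (W i)) (h : iIndepFun W μ) :
    entropy μ (fun ω i => W i ω) = ∑ i, entropy μ (W i) := by
  unfold entropy
  have h1 : ∀ s : Fin n → S, (μ ((fun ω i => W i ω) ⁻¹' {s})).toReal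
      = ∏ i, (μ (W i ⁻¹' {s i})).toReal := by
    intro s
    have := h.measure_inter_preimage_eq_mul Finset.univ (sets := fun i => {s i})
      (fun i _ => measurableSet_singleton _)
    rw [← ENNReal.toReal_prod, ← this]
    congr 2
    ext ω; simp [funext_iff]
  simp only [h1, sc_negMulLog_prod]
  rw [Finset.sum_comm]
  refine Finset.sum_congr rfl fun i _ => ?_
  have h2 := Fintype.prod_sum (fun (j : Fin n) (a : S) =>
    if j = i then Real.negMulLog (μ (W j ⁻¹' {a})).toReal else (μ (W j ⁻¹' {a})).toReal)
  rw [← h2, Finset.prod_eq_single i]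
  · simp
  · intro j _ hj
    simp only [if_neg hj]
    have := sum_measureReal_preimage_singleton (μ := μ) Finset.univ
      (f := W j) (fun y _ => hW j (measurableSet_singleton y))
    simpa [measureReal_def] using this
  · simp

lemma sc_ident {Ω S : Type*} [MeasurableSpace Ω] [Fintype S] [MeasurableSpace S]
    [MeasurableSingletonClass S] (μ : Measure Ω) (A B : Ω → S) (h : IdentDistrib A B μ μ) :
    entropy μ A = entropy μ B := by
  unfold entropy
  refine Finset.sum_congr rfl fun s _ => ?_
  rw [h.measure_mem_eq (measurableSet_singleton s)]

/-- Joint entropy of the first `j` bits and the side information. -/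
noncomputable def scPartial {Ω T : Type*} [MeasurableSpace Ω] [Fintype T] {n : ℕ}
    (μ : Measure Ω) (U : Ω → (Fin n → ZMod 2)) (Y : Ω → T) (j : ℕ) : ℝ :=
  entropy μ (fun ω => ((fun k : Fin j => if h : (k : ℕ) < n then U ω ⟨k, h⟩ else 0), Y ω))

lemma sc_step {Ω T : Type*} [MeasurableSpace Ω] [Fintype T] [MeasurableSpace T]
    [MeasurableSingletonClass T] {n : ℕ}
    (μ : Measure Ω) [IsProbabilityMeasure μ]
    (U : Ω → (Fin n → ZMod 2)) (hU : Measurable U) (Y : Ω → T) (hY : Measurable Y) (j : Fin n) :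
    scEntropy μ U Y j = scPartial μ U Y (j + 1) - scPartial μ U Y j := by
  have hUi : ∀ i, Measurable (fun ω => U ω i) := fun i => (measurable_pi_apply i).comp hU
  have hP : Measurable (fun ω =>
      ((fun k : Fin (j : ℕ) => U ω (Fin.castLE j.isLt.le k)), Y ω)) :=
    (measurable_pi_lambda _ fun k => hUi _).prodMk hY
  unfold scEntropy
  rw [sc_chain μ _ _ (fun s => hUi j (measurableSet_singleton s))
    (fun s => hP (measurableSet_singleton s))]
  unfold scPartial
  have e1 : (fun ω => ((fun k : Fin (j : ℕ) => U ω (Fin.castLE j.isLt.le k)), Y ω)) =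
      (fun ω => ((fun k : Fin (j : ℕ) => if h : (k : ℕ) < n then U ω ⟨k, h⟩ else 0), Y ω)) := by
    funext ω
    refine Prod.ext ?_ rfl
    funext k
    have : (k : ℕ) < n := by omega
    simp only [dif_pos this]
    rfl
  rw [← e1]
  congr 1
  let e : (ZMod 2 × ((Fin (j : ℕ) → ZMod 2) × T)) → ((Fin ((j : ℕ) + 1) → ZMod 2) × T) :=
    fun x => (Fin.snoc (α := fun _ => ZMod 2) x.2.1 x.1, x.2.2)
  have he : Function.Injective e := by
    rintro ⟨a, b, c⟩ ⟨a', b', c'⟩ h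
    simp only [e, Prod.mk.injEq] at h
    obtain ⟨h1, h2⟩ := h
    have h3 := Fin.snoc_injective2 h1
    simp [h3.1, h3.2, h2]
  rw [← sc_inj μ _ e he]
  congr 1
  funext ω
  refine Prod.ext ?_ rfl
  funext k
  induction k using Fin.lastCases with
  | last => simp [e]
  | cast i =>
    have hk : (i : ℕ) < n := by omega
    simp only [e, Fin.snoc_castSucc, Fin.val_castSucc, dif_pos hk]
    rfl

end Helpers

/-- (Conservation of total conditional entropy under invertible encoding,
equation (2).) If the codeword `X = U · G` (with `G` invertible over `ZMod 2`)
is transmitted through `n` i.i.d. channels producing outputs `Y_0, …, Y_{n-1}`,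
then the successive-cancellation entropies of `U` sum to
`n · H[X_0 | Y_0]`. -/
theorem total_sc_entropy_conservation
    {Ω 𝒴 : Type*} [MeasurableSpace Ω]
    [MeasurableSpace 𝒴] [Fintype 𝒴] [MeasurableSingletonClass 𝒴]
    (μ : Measure Ω) [IsProbabilityMeasure μ]
    {n : ℕ} (hn : 1 ≤ n)
    (U : Ω → (Fin n → ZMod 2)) (hU : Measurable U)
    (G : Matrix (Fin n) (Fin n) (ZMod 2)) (hG : IsUnit G)
    (X : Ω → (Fin n → ZMod 2)) (hX : ∀ ω, X ω = Matrix.vecMul (U ω) G)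
    (Y : Ω → (Fin n → 𝒴)) (hY : Measurable Y)
    (hindep : iIndepFun
      (fun i => fun ω => (X ω i, Y ω i)) μ)
    (hid : ∀ i : Fin n, IdentDistrib (fun ω => (X ω i, Y ω i))
      (fun ω => (X ω ⟨0, by omega⟩, Y ω ⟨0, by omega⟩)) μ μ) :
    ∑ j : Fin n, scEntropy μ U Y j =
      n * condEntropy μ (fun ω => X ω ⟨0, by omega⟩)
        (fun ω => Y ω ⟨0, by omega⟩) := by
  have hXi : ∀ i, Measurable (fun ω => X ω i) := by
    have : Measurable X := by
      have : X = (fun u => Matrix.vecMul u G) ∘ U := funext hX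
      rw [this]
      exact (measurable_of_countable _).comp hU
    exact fun i => (measurable_pi_apply i).comp this
  have hYi : ∀ i, Measurable (fun ω => Y ω i) := fun i => (measurable_pi_apply i).comp hY
  rw [Finset.sum_congr rfl (fun j _ => sc_step μ U hU Y hY j),
    Fin.sum_univ_eq_sum_range (fun j => scPartial μ U Y (j + 1) - scPartial μ U Y j),
    Finset.sum_range_sub]
  rw [sc_chain μ _ _ (fun s => hXi _ (measurableSet_singleton s))
    (fun s => hYi _ (measurableSet_singleton s))]
  have hn' : scPartial μ U Y n = n * entropy μ
      (fun ω => (X ω ⟨0, by omega⟩, Y ω ⟨0, by omega⟩)) := by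
    have h1 := sc_indep μ _ (fun i => (hXi i).prodMk (hYi i)) hindep
    rw [Finset.sum_congr rfl (fun i _ => sc_ident μ _ _ (hid i))] at h1
    simp only [Finset.sum_const, Finset.card_univ, Fintype.card_fin, nsmul_eq_mul] at h1
    rw [← h1]
    let e : (Fin n → ZMod 2) × (Fin n → 𝒴) → (Fin n → ZMod 2 × 𝒴) :=
      fun x i => (Matrix.vecMul x.1 G i, x.2 i)
    have he : Function.Injective e := by
      rintro ⟨a, b⟩ ⟨a', b'⟩ h
      have h2 : Matrix.vecMul a G = Matrix.vecMul a' G :=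
        funext fun i => congrArg Prod.fst (congrFun h i)
      have h3 : b = b' := funext fun i => congrArg Prod.snd (congrFun h i)
      rw [Matrix.vecMul_injective_of_isUnit hG h2, h3]
    unfold scPartial
    rw [← sc_inj μ _ e he]
    congr 1
    funext ω i
    simp [e, hX]
  have h0' : scPartial μ U Y 0 = n * entropy μ (fun ω => Y ω ⟨0, by omega⟩) := by
    have h1 := sc_indep μ _ hYi (hindep.comp (fun _ => Prod.snd) (fun _ => measurable_snd))
    have h2 : ∀ i, entropy μ (fun ω => Y ω i) = entropy μ (fun ω => Y ω ⟨0, by omega⟩) :=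
      fun i => sc_ident μ _ _ ((hid i).comp measurable_snd)
    rw [Finset.sum_congr rfl (fun i _ => h2 i)] at h1
    simp only [Finset.sum_const, Finset.card_univ, Fintype.card_fin, nsmul_eq_mul] at h1
    refine Eq.trans ?_ h1
    unfold scPartial
    rw [← sc_inj μ _ Prod.snd]
    rintro ⟨a, b⟩ ⟨a', b'⟩ h
    exact Prod.ext (Subsingleton.elim _ _) h
  rw [hn', h0']
  ring
end
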